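/- Let I be an index set, D an ultrafilter on I, and ε > 0 a real number. For each i ∈ I, let X_i be a topological space, ν_i a Borel probability measure on X_i, S_i ⊆ X_i a dense subset, and g_i, h_i : X_i → [0,1] continuous functions. Assume that for every choice function c with c(i) ∈ S_i for all i, and all real numbers u, v, if (g_i(c(i)))_{i∈I} converges to u along D and (h_i(c(i)))_{i∈I} converges to v along D, then |u − v| < ε. Then for all real numbers r, s such that (∫_{X_i} g_i dν_i)_{i∈I} converges to r along D and (∫_{X_i} h_i dν_i)_{i∈I} converges to s along D, one has |r − s| ≤ ε. -/

import Mathlib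

open MeasureTheory

/-- `IsDLim D f r`: the real `r` is the limit of the family `f` along the ultrafilter `D`,
i.e. for every `δ > 0` the set `{i | |f i - r| ≤ δ}` belongs to `D`. -/
def IsDLim {I : Type*} (D : Ultrafilter I) (f : I → ℝ) (r : ℝ) : Prop :=
  ∀ δ : ℝ, 0 < δ → {i | |f i - r| ≤ δ} ∈ D

theorem isDLim_iff_tendsto {I : Type*} {D : Ultrafilter I} {f : I → ℝ} {r : ℝ} :
    IsDLim D f r ↔ Filter.Tendsto f D (nhds r) := by
  rw [Metric.nhds_basis_closedBall.tendsto_right_iff]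
  rfl

theorem exists_isDLim_of_mem_Icc {I : Type*} (D : Ultrafilter I) {a b : ℝ} {f : I → ℝ}
    (hf : ∀ i, f i ∈ Set.Icc a b) : ∃ r, IsDLim D f r := by
  obtain ⟨r, -, hr⟩ := (isCompact_Icc (a := a) (b := b)).ultrafilter_le_nhds (D.map f)
    (Filter.le_principal_iff.2 (Filter.mem_map.2 (Filter.univ_mem' hf)))
  exact ⟨r, isDLim_iff_tendsto.2 hr⟩

theorem Continuous.integrable_of_mem_Icc {X : Type*} [TopologicalSpace X] [MeasurableSpace X]
    [OpensMeasurableSpace X] {μ : Measure X} [IsFiniteMeasure μ] {f : X → ℝ} {a b : ℝ}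
    (hf : Continuous f) (hab : ∀ x, f x ∈ Set.Icc a b) : Integrable f μ :=
  Integrable.of_mem_Icc a b hf.measurable.aemeasurable (Filter.Eventually.of_forall hab)

/-- Let `D` be an ultrafilter on `I`, `ε > 0`, and for each `i` let `ν i` be a
Borel probability measure on a topological space `X i`, `S i ⊆ X i` dense, and
`g i, h i : X i → [0,1]` continuous. If for every choice function `c` through the `S i` the
`D`-limits of `(g i (c i))` and `(h i (c i))` are always within `ε` of each other (strictly),
then the `D`-limits of the integrals `∫ g i dν i` and `∫ h i dν i` are within `ε` of each
other. -/
theorem dLim_integral_close {I : Type*} (D : Ultrafilter I) (ε : ℝ) (hε : 0 < ε)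
    (X : I → Type*) [∀ i, TopologicalSpace (X i)] [∀ i, MeasurableSpace (X i)]
    [∀ i, OpensMeasurableSpace (X i)]
    (ν : ∀ i, Measure (X i)) [∀ i, IsProbabilityMeasure (ν i)]
    (S : ∀ i, Set (X i)) (hS : ∀ i, Dense (S i))
    (g h : ∀ i, X i → ℝ)
    (hgc : ∀ i, Continuous (g i)) (hhc : ∀ i, Continuous (h i))
    (hg01 : ∀ i x, g i x ∈ Set.Icc (0 : ℝ) 1) (hh01 : ∀ i x, h i x ∈ Set.Icc (0 : ℝ) 1)
    (hmain : ∀ c : ∀ i, X i, (∀ i, c i ∈ S i) → ∀ u v : ℝ,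
      IsDLim D (fun i => g i (c i)) u → IsDLim D (fun i => h i (c i)) v → |u - v| < ε)
    (r s : ℝ)
    (hr : IsDLim D (fun i => ∫ x, g i x ∂(ν i)) r)
    (hs : IsDLim D (fun i => ∫ x, h i x ∂(ν i)) s) :
    |r - s| ≤ ε := by
  have hclose : ∀ᶠ i in (D : Filter I), ∀ x, |g i x - h i x| ≤ ε := by
    by_contra hfar
    rw [← Ultrafilter.eventually_not] at hfar
    have hchoice : ∀ i, ∃ x ∈ S i, (¬ ∀ y, |g i y - h i y| ≤ ε) → ε < |g i x - h i x| := by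
      intro i
      by_cases hi : ∀ y, |g i y - h i y| ≤ ε
      · have : Nonempty (X i) := (ν i).nonempty_of_neZero
        obtain ⟨x, hx⟩ := (hS i).nonempty
        exact ⟨x, hx, fun hn => absurd hi hn⟩
      · obtain ⟨y, hy⟩ := not_forall.1 hi
        obtain ⟨x, hxS, hx⟩ := (hS i).exists_mem_open
          (isOpen_lt continuous_const ((hgc i).sub (hhc i)).abs) ⟨y, not_le.1 hy⟩
        exact ⟨x, hxS, fun _ => hx⟩
    choose c hcS hc using hchoice
    obtain ⟨u, hu⟩ := exists_isDLim_of_mem_Icc D fun i => hg01 i (c i)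
    obtain ⟨v, hv⟩ := exists_isDLim_of_mem_Icc D fun i => hh01 i (c i)
    refine (hmain c hcS u v hu hv).not_ge ?_
    exact ge_of_tendsto ((isDLim_iff_tendsto.1 hu).sub (isDLim_iff_tendsto.1 hv)).abs
      (hfar.mono fun i hi => (hc i hi).le)
  refine le_of_tendsto ((isDLim_iff_tendsto.1 hr).sub (isDLim_iff_tendsto.1 hs)).abs
    (hclose.mono fun i hi => ?_)
  rw [← integral_sub ((hgc i).integrable_of_mem_Icc (hg01 i))
    ((hhc i).integrable_of_mem_Icc (hh01 i))]
  simpa using norm_integral_le_of_norm_le_const (μ := ν i)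
    (f := fun x => g i x - h i x) (Filter.Eventually.of_forall hi)
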